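/- arXiv:1607.06335 — 4 statements merged into one kernel-verified Lean document; each statement's English description precedes it below -/
import Mathlib

section
/- Let (X, A_X) be a finite network and let β > 0. Define the grafted function u^{R/NR}(x,x';β) = u^{NR}(x,x') if u^{R}(x,x') ≤ β, and u^{R/NR}(x,x';β) = u^{R}(x,x') if u^{R}(x,x') > β. Then u^{R/NR}(·,·;β) satisfies the strong triangle inequality: for all x, x', x'' ∈ X, u^{R/NR}(x,x';β) ≤ max(u^{R/NR}(x,x'';β), u^{R/NR}(x'',x';β)); together with its symmetry and identity properties this makes it a valid ultrametric on X. -/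
noncomputable section

/-- Cost of a chain (a finite ordered list of nodes): the maximum dissimilarity
encountered over consecutive pairs (0 for chains with fewer than two nodes). -/
def chainCost {X : Type*} (A : X → X → ℝ) : List X → ℝ
  | [] => 0
  | [_] => 0
  | a :: b :: rest => max (A a b) (chainCost A (b :: rest))

/-- The set of costs of chains from `x` to `x'`. -/
def chainCosts {X : Type*} (A : X → X → ℝ) (x x' : X) : Set ℝ :=
  { c | ∃ l : List X, l.head? = some x ∧ l.getLast? = some x' ∧ chainCost A l = c }

/-- Directed minimum chain cost ũ*(x,x'). -/
def minChainCost {X : Type*} (A : X → X → ℝ) (x x' : X) : ℝ :=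
  sInf (chainCosts A x x')

/-- The reciprocal ultrametric u^R. -/
def uR {X : Type*} (A : X → X → ℝ) (x x' : X) : ℝ :=
  minChainCost (fun a b => max (A a b) (A b a)) x x'

/-- The nonreciprocal ultrametric u^NR. -/
def uNR {X : Type*} (A : X → X → ℝ) (x x' : X) : ℝ :=
  max (minChainCost A x x') (minChainCost A x' x)

/-- The set of costs of chains from `x` to `x'` having at most `t` nodes. -/
def boundedChainCosts {X : Type*} (A : X → X → ℝ) (t : ℕ) (x x' : X) : Set ℝ :=
  { c | ∃ l : List X, l.head? = some x ∧ l.getLast? = some x' ∧ l.length ≤ t ∧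
      chainCost A l = c }

/-- A^{SR(t)}(x,x'): minimum cost over chains from `x` to `x'` with at most `t` nodes. -/
def ASR {X : Type*} (A : X → X → ℝ) (t : ℕ) (x x' : X) : ℝ :=
  sInf (boundedChainCosts A t x x')

/-- The semi-reciprocal ultrametric u^{SR(t)}. -/
def uSR {X : Type*} (A : X → X → ℝ) (t : ℕ) (x x' : X) : ℝ :=
  minChainCost (fun a b => max (ASR A t a b) (ASR A t b a)) x x'

/-- The grafted function u^{R/NR}(·,·;β). -/
def uRNR {X : Type*} (A : X → X → ℝ) (β : ℝ) (x x' : X) : ℝ :=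
  if uR A x x' ≤ β then uNR A x x' else uR A x x'

theorem chainCost_nonneg {X : Type*} (A : X → X → ℝ) : ∀ l : List X, 0 ≤ chainCost A l
  | [] => le_rfl
  | [_] => le_rfl
  | _ :: b :: rest => le_max_of_le_right (chainCost_nonneg A (b :: rest))

theorem reflTransGen_of_chainCost_lt {X : Type*} (A : X → X → ℝ) {c : ℝ} {y : X} :
    ∀ (l : List X) (x : X), l.head? = some x → l.getLast? = some y → chainCost A l < c →
      Relation.ReflTransGen (fun a b => A a b < c) x y
  | [], x, hx, _, _ => by simp at hx
  | [a], x, hx, hy, _ => by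
      obtain rfl : a = x := by simpa using hx
      obtain rfl : a = y := by simpa using hy
      exact .refl
  | a :: b :: rest, x, hx, hy, hc => by
      obtain rfl : a = x := by simpa using hx
      rw [chainCost, max_lt_iff] at hc
      rw [List.getLast?_cons_cons] at hy
      exact .head hc.1 (reflTransGen_of_chainCost_lt A (b :: rest) b rfl hy hc.2)

theorem exists_chainCost_lt {X : Type*} (A : X → X → ℝ) {c : ℝ} (hc : 0 < c) {x y : X}
    (h : Relation.ReflTransGen (fun a b => A a b < c) x y) :
    ∃ l : List X, l.head? = some x ∧ l.getLast? = some y ∧ chainCost A l < c := by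
  induction h using Relation.ReflTransGen.head_induction_on with
  | refl => exact ⟨[y], rfl, rfl, hc⟩
  | @head a b hab _ ih =>
    obtain ⟨l, hl, hy, hlc⟩ := ih
    obtain ⟨l, rfl⟩ := List.head?_eq_some_iff.1 hl
    exact ⟨a :: b :: l, rfl, by rwa [List.getLast?_cons_cons], max_lt hab hlc⟩

theorem chainCosts_nonempty {X : Type*} (A : X → X → ℝ) (x y : X) :
    (chainCosts A x y).Nonempty :=
  ⟨_, [x, y], rfl, rfl, rfl⟩

theorem minChainCost_nonneg {X : Type*} (A : X → X → ℝ) (x y : X) :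
    0 ≤ minChainCost A x y := by
  apply Real.sInf_nonneg
  rintro _ ⟨l, -, -, rfl⟩
  exact chainCost_nonneg A l

theorem minChainCost_lt_iff {X : Type*} (A : X → X → ℝ) {x y : X} {c : ℝ} :
    minChainCost A x y < c ↔ 0 < c ∧ Relation.ReflTransGen (fun a b => A a b < c) x y := by
  constructor
  · intro h
    refine ⟨(minChainCost_nonneg A x y).trans_lt h, ?_⟩
    obtain ⟨_, ⟨l, hx, hy, rfl⟩, hc⟩ := exists_lt_of_csInf_lt (chainCosts_nonempty A x y) h
    exact reflTransGen_of_chainCost_lt A l x hx hy hc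
  · rintro ⟨hc, h⟩
    obtain ⟨l, hx, hy, hlc⟩ := exists_chainCost_lt A hc h
    refine (csInf_le (s := chainCosts A x y) ⟨0, ?_⟩ ⟨l, hx, hy, rfl⟩).trans_lt hlc
    rintro _ ⟨l, -, -, rfl⟩
    exact chainCost_nonneg A l

theorem minChainCost_self {X : Type*} (A : X → X → ℝ) (x : X) : minChainCost A x x = 0 :=
  (minChainCost_nonneg A x x).antisymm' <|
    le_of_forall_gt fun _ hc => (minChainCost_lt_iff A).2 ⟨hc, .refl⟩

theorem minChainCost_triangle {X : Type*} (A : X → X → ℝ) (x y z : X) :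
    minChainCost A x z ≤ max (minChainCost A x y) (minChainCost A y z) := by
  refine le_of_forall_gt fun c hc => ?_
  simp only [max_lt_iff, minChainCost_lt_iff] at hc ⊢
  exact ⟨hc.1.1, hc.1.2.trans hc.2.2⟩

theorem minChainCost_mono {X : Type*} {A B : X → X → ℝ} (h : ∀ a b, A a b ≤ B a b) (x y : X) :
    minChainCost A x y ≤ minChainCost B x y := by
  refine le_of_forall_gt fun c hc => ?_
  rw [minChainCost_lt_iff] at hc ⊢
  exact ⟨hc.1, Relation.ReflTransGen.mono (fun a b hab => (h a b).trans_lt hab) _ _ hc.2⟩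

theorem eq_of_minChainCost_eq_zero {X : Type*} [Finite X] {A : X → X → ℝ}
    (hA : ∀ a b, a ≠ b → 0 < A a b) {x y : X} (h : minChainCost A x y = 0) : x = y := by
  obtain ⟨δ, hδ, hAδ⟩ : ∃ δ > 0, ∀ a b, a ≠ b → δ ≤ A a b := by
    rcases isEmpty_or_nonempty {p : X × X // p.1 ≠ p.2} with he | hne
    · exact ⟨1, one_pos, fun a b hab => (he.false ⟨(a, b), hab⟩).elim⟩
    · obtain ⟨p, hp⟩ := Finite.exists_min fun p : {p : X × X // p.1 ≠ p.2} => A p.1.1 p.1.2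
      exact ⟨_, hA _ _ p.2, fun a b hab => hp ⟨(a, b), hab⟩⟩
  have hxy := ((minChainCost_lt_iff A).1 (h.trans_lt hδ)).2
  induction hxy with
  | refl => rfl
  | @tail b c _ hbc ih =>
    obtain rfl : b = c := by_contra fun hne => (hAδ b c hne).not_gt hbc
    exact ih h

theorem uR_symm {X : Type*} (A : X → X → ℝ) (x y : X) : uR A x y = uR A y x := by
  refine eq_of_forall_gt_iff fun c => ?_
  have key : Std.Symm (fun a b => max (A a b) (A b a) < c) :=
    ⟨fun a b h => by rwa [max_comm]⟩
  simp only [uR, minChainCost_lt_iff]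
  exact and_congr_right fun _ => ⟨fun h => symm h, fun h => symm h⟩

theorem uNR_symm {X : Type*} (A : X → X → ℝ) (x y : X) : uNR A x y = uNR A y x :=
  max_comm _ _

theorem uNR_le_uR {X : Type*} (A : X → X → ℝ) (x y : X) : uNR A x y ≤ uR A x y :=
  max_le (minChainCost_mono (fun _ _ => le_max_left _ _) x y)
    (uR_symm A x y ▸ minChainCost_mono (fun _ _ => le_max_left _ _) y x)

theorem uR_triangle {X : Type*} (A : X → X → ℝ) (x y z : X) :
    uR A x z ≤ max (uR A x y) (uR A y z) :=
  minChainCost_triangle _ x y z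

theorem uNR_triangle {X : Type*} (A : X → X → ℝ) (x y z : X) :
    uNR A x z ≤ max (uNR A x y) (uNR A y z) := by
  have h₁ := minChainCost_triangle A x y z
  have h₂ := minChainCost_triangle A z y x
  simp only [uNR]
  grind

/-- the grafted function u^{R/NR}(·,·;β) is a valid ultrametric:
it is symmetric, vanishes exactly on the diagonal, and satisfies the strong
triangle inequality. -/
theorem grafting_RNR_is_ultrametric {X : Type*} [Fintype X]
    (A : X → X → ℝ)
    (hnonneg : ∀ x x' : X, 0 ≤ A x x')
    (hid : ∀ x x' : X, A x x' = 0 ↔ x = x')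
    (β : ℝ) (hβ : 0 < β) :
    (∀ x x' : X, uRNR A β x x' = uRNR A β x' x) ∧
    (∀ x x' : X, uRNR A β x x' = 0 ↔ x = x') ∧
    (∀ x x' x'' : X, uRNR A β x x' ≤ max (uRNR A β x x'') (uRNR A β x'' x')) := by
  refine ⟨fun x y => ?_, fun x y => ⟨fun h => ?_, ?_⟩, fun x z y => ?_⟩
  · simp only [uRNR, uR_symm A x y, uNR_symm A x y]
  · have hNR : minChainCost A x y ≤ 0 := by
      refine (le_max_left _ (minChainCost A y x)).trans (le_trans ?_ h.le)
      rw [uRNR]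
      split_ifs
      exacts [le_rfl, uNR_le_uR A x y]
    exact eq_of_minChainCost_eq_zero
      (fun a b hab => (hnonneg a b).lt_of_ne fun h0 => hab ((hid a b).1 h0.symm))
      (hNR.antisymm (minChainCost_nonneg A x y))
  · rintro rfl
    simp [uRNR, uR, uNR, minChainCost_self, hβ.le]
  · have hR := uR_triangle A x y z
    have hNR := uNR_triangle A x y z
    have hle := uNR_le_uR A x z
    simp only [uRNR]
    grind
end
end

section
/- Consider the four-node network X = {a,b,c,d} with dissimilarities A(a,b) = 1, A(b,c) = 1, A(c,d) = 1, A(d,a) = 1, A(b,a) = 3, A(c,b) = 5, A(d,c) = 2, A(a,d) = 5 and all remaining off-diagonal dissimilarities equal to 6. Define u^{R/R}(x,x';β) = u^{R}(x,x') if u^{R}(x,x') ≤ β and u^{R/R}(x,x';β) = u^{NR}(x,x') otherwise. Then for β = 4 one has u^{R/R}(a,b;4) = 3, u^{R/R}(a,c;4) = 1, and u^{R/R}(c,b;4) = 1, so u^{R/R}(a,b;4) > max(u^{R/R}(a,c;4), u^{R/R}(c,b;4)); hence u^{R/R}(·,·;4) violates the strong triangle inequality and is not an ultrametric. -/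
noncomputable section

/-- The (invalid) grafted function u^{R/R}(·,·;β). -/
def uRR {X : Type*} (A : X → X → ℝ) (β : ℝ) (x x' : X) : ℝ :=
  if uR A x x' ≤ β then uR A x x' else uNR A x x'

/-- The four-node counterexample network on nodes a = 0, b = 1, c = 2, d = 3. -/
def A4 : Fin 4 → Fin 4 → ℝ := fun i j =>
  if i = j then 0
  else if i = 0 ∧ j = 1 then 1
  else if i = 1 ∧ j = 2 then 1
  else if i = 2 ∧ j = 3 then 1
  else if i = 3 ∧ j = 0 then 1
  else if i = 1 ∧ j = 0 then 3
  else if i = 2 ∧ j = 1 then 5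
  else if i = 3 ∧ j = 2 then 2
  else if i = 0 ∧ j = 3 then 5
  else 6

/-- A chain leaving `S` costs at least as much as every arc crossing out of `S`. -/
theorem le_chainCost_of_cut {X : Type*} {A : X → X → ℝ} {S : Set X} {r : ℝ} {x' : X}
    (hx' : x' ∉ S) (hcut : ∀ i ∈ S, ∀ j ∉ S, r ≤ A i j) :
    ∀ (l : List X) (x : X), x ∈ S → l.head? = some x → l.getLast? = some x' →
      r ≤ chainCost A l
  | [], _, _, h, _ => by simp at h
  | [a], x, hx, h, h' => by
    simp only [List.head?_cons, List.getLast?_singleton, Option.some.injEq] at h h'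
    subst h h'
    exact absurd hx hx'
  | a :: b :: rest, x, hx, h, h' => by
    simp only [List.head?_cons, Option.some.injEq] at h
    subst h
    rw [List.getLast?_cons_cons] at h'
    by_cases hb : b ∈ S
    · exact le_max_of_le_right (le_chainCost_of_cut hx' hcut (b :: rest) b hb rfl h')
    · exact le_max_of_le_left (hcut a hx b hb)

theorem minChainCost_eq_of_chain_of_cut {X : Type*} {A : X → X → ℝ} {x x' : X} {r : ℝ}
    (l : List X) (hl : l.head? = some x) (hl' : l.getLast? = some x')
    (hcost : chainCost A l = r) (S : Set X) (hx : x ∈ S) (hx' : x' ∉ S)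
    (hcut : ∀ i ∈ S, ∀ j ∉ S, r ≤ A i j) : minChainCost A x x' = r :=
  IsLeast.csInf_eq ⟨⟨l, hl, hl', hcost⟩, by
    rintro _ ⟨m, hm, hm', rfl⟩
    exact le_chainCost_of_cut hx' hcut m x hx hm hm'⟩

theorem one_le_A4 {i j : Fin 4} (h : i ≠ j) : 1 ≤ A4 i j := by
  unfold A4
  split_ifs <;> first | contradiction | norm_num

theorem minChainCost_A4_eq_one {x x' : Fin 4} (h : x ≠ x') (l : List (Fin 4))
    (hl : l.head? = some x) (hl' : l.getLast? = some x') (hcost : chainCost A4 l = 1) :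
    minChainCost A4 x x' = 1 :=
  minChainCost_eq_of_chain_of_cut l hl hl' hcost {x} rfl h.symm fun _ hi _ hj =>
    one_le_A4 fun hij => hj (hij ▸ hi)

theorem uNR_A4_zero_two : uNR A4 0 2 = 1 := by
  rw [uNR,
    minChainCost_A4_eq_one (x' := 2) (by decide) [0, 1, 2] rfl rfl (by simp [chainCost, A4]),
    minChainCost_A4_eq_one (x' := 0) (by decide) [2, 3, 0] rfl rfl (by simp [chainCost, A4]), max_self]

theorem uNR_A4_two_one : uNR A4 2 1 = 1 := by
  rw [uNR,
    minChainCost_A4_eq_one (x' := 1) (by decide) [2, 3, 0, 1] rfl rfl (by simp [chainCost, A4]),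
    minChainCost_A4_eq_one (x' := 2) (by decide) [1, 2] rfl rfl (by simp [chainCost, A4]), max_self]

theorem uR_A4_zero_one : uR A4 0 1 = 3 := by
  refine minChainCost_eq_of_chain_of_cut [0, 1] rfl rfl (by norm_num [chainCost, A4, Fin.ext_iff]) {0}
    (by simp) (by simp) fun i hi j hj => ?_
  fin_cases i <;> fin_cases j <;> simp_all [A4] <;> norm_num

theorem uR_A4_zero_two : uR A4 0 2 = 5 := by
  refine minChainCost_eq_of_chain_of_cut [0, 1, 2] rfl rfl (by norm_num [chainCost, A4, Fin.ext_iff]) {0, 1}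
    (by simp) (by simp) fun i hi j hj => ?_
  fin_cases i <;> fin_cases j <;> simp_all [A4] <;> norm_num

theorem uR_A4_two_one : uR A4 2 1 = 5 := by
  refine minChainCost_eq_of_chain_of_cut [2, 1] rfl rfl (by norm_num [chainCost, A4, Fin.ext_iff]) {2, 3}
    (by simp) (by simp) fun i hi j hj => ?_
  fin_cases i <;> fin_cases j <;> simp_all [A4] <;> norm_num

/-- in the four-node network above, with β = 4 one has
u^{R/R}(a,b;4) = 3, u^{R/R}(a,c;4) = 1, u^{R/R}(c,b;4) = 1, so
u^{R/R}(a,b;4) > max(u^{R/R}(a,c;4), u^{R/R}(c,b;4)); hence u^{R/R}(·,·;4)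
violates the strong triangle inequality and is not an ultrametric. -/
theorem grafting_RR_not_ultrametric :
    uRR A4 4 0 1 = 3 ∧ uRR A4 4 0 2 = 1 ∧ uRR A4 4 2 1 = 1 ∧
    max (uRR A4 4 0 2) (uRR A4 4 2 1) < uRR A4 4 0 1 ∧
    ¬ (∀ x x' x'' : Fin 4, uRR A4 4 x x' ≤ max (uRR A4 4 x x'') (uRR A4 4 x'' x')) := by
  have h01 : uRR A4 4 0 1 = 3 := by norm_num [uRR, uR_A4_zero_one]
  have h02 : uRR A4 4 0 2 = 1 := by norm_num [uRR, uR_A4_zero_two, uNR_A4_zero_two]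
  have h21 : uRR A4 4 2 1 = 1 := by norm_num [uRR, uR_A4_two_one, uNR_A4_two_one]
  have hlt : max (uRR A4 4 0 2) (uRR A4 4 2 1) < uRR A4 4 0 1 := by norm_num [h01, h02, h21]
  exact ⟨h01, h02, h21, hlt, fun h => (h 0 1 2).not_gt hlt⟩
end
end

section
/- Let u be an n×n symmetric matrix with nonnegative real entries, zero diagonal, and positive off-diagonal entries. Then u satisfies the strong triangle inequality (u_{ij} ≤ max(u_{ik}, u_{kj}) for all i, j, k), i.e., u is the matrix of a finite ultrametric, if and only if u is idempotent in the min-max dioid algebra: u ⊗ u = u, where [u ⊗ u]_{ij} = min over k of max(u_{ik}, u_{kj}). -/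
noncomputable section

/-- The min-max dioid product of square matrices. -/
def dioidMul {n : ℕ} (A B : Fin n → Fin n → ℝ) : Fin n → Fin n → ℝ :=
  fun i j => ⨅ k : Fin n, max (A i k) (B k j)

/-- Dioid powers: `dioidPow A l` is the `l`-th power `A^l` of `A` in the min-max
dioid algebra (with the convention `A^0 = A`, which is never used for `l ≥ 1`). -/
def dioidPow {n : ℕ} (A : Fin n → Fin n → ℝ) : ℕ → Fin n → Fin n → ℝ
  | 0 => A
  | 1 => A
  | (k + 2) => dioidMul A (dioidPow A (k + 1))

/-- An entry of the min-max dioid product is at most each of the terms it minimizes. -/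
theorem dioidMul_le {n : ℕ} (A B : Fin n → Fin n → ℝ) (i j k : Fin n) :
    dioidMul A B i j ≤ max (A i k) (B k j) :=
  ciInf_le (Set.finite_range fun k => max (A i k) (B k j)).bddBelow k

/-- a symmetric nonnegative matrix with zero diagonal and positive
off-diagonal entries satisfies the strong triangle inequality (i.e., is a finite
ultrametric matrix) if and only if it is idempotent in the min-max dioid algebra:
u ⊗ u = u. -/
theorem ultrametric_iff_dioid_idempotent (n : ℕ) (u : Fin n → Fin n → ℝ)
    (hnonneg : ∀ i j : Fin n, 0 ≤ u i j)
    (hsymm : ∀ i j : Fin n, u i j = u j i)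
    (hdiag : ∀ i : Fin n, u i i = 0)
    (hoff : ∀ i j : Fin n, i ≠ j → 0 < u i j) :
    (∀ i j k : Fin n, u i j ≤ max (u i k) (u k j)) ↔ dioidMul u u = u := by
  constructor
  · intro h
    funext i j
    have : Nonempty (Fin n) := ⟨i⟩
    refine le_antisymm ?_ (le_ciInf fun k => h i j k)
    simpa [hdiag, hnonneg] using dioidMul_le u u i j j
  · intro h i j k
    simpa only [h] using dioidMul_le u u i j k
end
end

section
/- Let (X, A_X) be a finite network and let t, t' > 0 be positive integers. Define A^{t,t'}(x,x') = max(A^{SR(t+1)}(x,x'), A^{SR(t'+1)}(x',x)) and u^{t,t'}(x,x') = min over chains C(x,x') of max_i A^{t,t'}(x_i, x_{i+1}). Then u^{t,t'} is symmetric: for all x, x' ∈ X, u^{t,t'}(x,x') = u^{t,t'}(x',x). In particular, if u^{t,t'}(x,x') = δ then u^{t,t'}(x',x) ≤ δ. -/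
noncomputable section

/-- The algorithmic intermediate ultrametric u^{t,t'}: minimum chain cost with
respect to A^{t,t'}(x,x') = max(A^{SR(t+1)}(x,x'), A^{SR(t'+1)}(x',x)). -/
def uTT {X : Type*} (A : X → X → ℝ) (t t' : ℕ) (x x' : X) : ℝ :=
  minChainCost (fun a b => max (ASR A (t + 1) a b) (ASR A (t' + 1) b a)) x x'

theorem chainCost_le_iff {X : Type*} (A : X → X → ℝ) {δ : ℝ} (hδ : 0 ≤ δ) :
    ∀ l : List X, chainCost A l ≤ δ ↔ l.IsChain (fun a b => A a b ≤ δ)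
  | [] => by simpa [chainCost] using hδ
  | [_] => by simpa [chainCost] using hδ
  | a :: b :: rest => by
    rw [chainCost, max_le_iff, List.isChain_cons_cons, chainCost_le_iff A hδ (b :: rest)]

theorem chainCost_mem {X : Type*} (A : X → X → ℝ) :
    ∀ l : List X, chainCost A l ∈ insert 0 (Set.range (Function.uncurry A))
  | [] => Or.inl rfl
  | [_] => Or.inl rfl
  | a :: b :: rest => by
    rcases max_choice (A a b) (chainCost A (b :: rest)) with h | h
    · rw [chainCost, h]
      exact Or.inr ⟨(a, b), rfl⟩
    · rw [chainCost, h]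
      exact chainCost_mem A (b :: rest)

theorem minChainCost_mem {X : Type*} [Finite X] (A : X → X → ℝ) (x y : X) :
    minChainCost A x y ∈ chainCosts A x y := by
  refine Set.Nonempty.csInf_mem ⟨_, [x, y], rfl, rfl, rfl⟩ ?_
  refine ((Set.finite_range (Function.uncurry A)).insert 0).subset ?_
  rintro _ ⟨l, -, -, rfl⟩
  exact chainCost_mem A l

theorem ASR_mem {X : Type*} [Finite X] (A : X → X → ℝ) {t : ℕ} (ht : 2 ≤ t) (x y : X) :
    ASR A t x y ∈ boundedChainCosts A t x y := by
  refine Set.Nonempty.csInf_mem ⟨_, [x, y], rfl, rfl, ht, rfl⟩ ?_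
  refine ((Set.finite_range (Function.uncurry A)).insert 0).subset ?_
  rintro _ ⟨l, -, -, -, rfl⟩
  exact chainCost_mem A l

theorem minChainCost_le_iff {X : Type*} [Finite X] (A : X → X → ℝ) {δ : ℝ} (hδ : 0 ≤ δ)
    (x y : X) :
    minChainCost A x y ≤ δ ↔ Relation.ReflTransGen (fun a b => A a b ≤ δ) x y := by
  constructor
  · intro h
    obtain ⟨l, hx, hy, hl⟩ := minChainCost_mem A x y
    rw [← hl, chainCost_le_iff A hδ] at h
    have hne : l ≠ [] := by rintro rfl; simp at hx
    have := List.relationReflTransGen_of_exists_isChain l h hne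
    rwa [List.head_of_head?_eq_some hx, List.getLast_of_getLast?_eq_some hy] at this
  · intro h
    obtain ⟨l, hne, hl, rfl, rfl⟩ := List.exists_isChain_ne_nil_of_relationReflTransGen h
    refine (csInf_le (s := chainCosts A _ _) ⟨0, ?_⟩ ⟨l, List.head?_eq_some_head hne,
      List.getLast?_eq_some_getLast hne, rfl⟩).trans ((chainCost_le_iff A hδ l).2 hl)
    rintro _ ⟨l', -, -, rfl⟩
    exact chainCost_nonneg A l'

/-- Since repeating a node is free, chains with at most `m + 1` nodes can be replaced by walks with
exactly `m` steps. -/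
theorem ASR_le_iff {X : Type*} [Finite X] (A : X → X → ℝ) (hself : ∀ x, A x x = 0) {δ : ℝ}
    (hδ : 0 ≤ δ) {m : ℕ} (hm : 0 < m) (x y : X) :
    ASR A (m + 1) x y ≤ δ ↔
      ∃ f : ℕ → X, f 0 = x ∧ f m = y ∧ ∀ i < m, A (f i) (f (i + 1)) ≤ δ := by
  constructor
  · intro h
    obtain ⟨l, hx, hy, hlen, hl⟩ := ASR_mem A (by omega : 2 ≤ m + 1) x y
    rw [← hl, chainCost_le_iff A hδ, List.isChain_iff_getElem] at h
    rw [List.head?_eq_getElem?] at hx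
    rw [List.getLast?_eq_getElem?] at hy
    have hlast : ∀ i, l.length ≤ i + 1 → l[i]?.getD y = y := by
      intro i hi
      rcases Nat.lt_or_ge i l.length with hi' | hi'
      · obtain rfl : i = l.length - 1 := by omega
        simp [hy]
      · simp [List.getElem?_eq_none hi']
    refine ⟨fun i => l[i]?.getD y, by simp [hx], hlast m hlen, fun i _ => ?_⟩
    rcases Nat.lt_or_ge (i + 1) l.length with hi | hi
    · simpa [List.getElem?_eq_getElem hi, List.getElem?_eq_getElem (Nat.lt_of_succ_lt hi)]
        using h i hi
    · simpa only [hlast i hi, hlast (i + 1) (by omega), hself] using hδ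
  · rintro ⟨f, rfl, rfl, hf⟩
    refine (csInf_le (s := boundedChainCosts A _ _ _) ⟨0, ?_⟩
      ⟨List.ofFn (fun i : Fin (m + 1) => f i), ?_, ?_, ?_, rfl⟩).trans ((chainCost_le_iff A hδ _).2 ?_)
    · rintro _ ⟨l, -, -, -, rfl⟩
      exact chainCost_nonneg A l
    · simp [List.head?_eq_getElem?]
    · simp [List.getLast?_eq_getElem?, -List.ofFn_succ]
    · simp
    · rw [List.isChain_iff_getElem]
      intro i hi
      simp only [List.length_ofFn] at hi
      simpa [-List.ofFn_succ] using hf i (by omega)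

/-- The two walks witnessing `A^{t,t'}(a, b) ≤ δ` form a closed walk of length `t + t'`. -/
theorem exists_periodic_walk {X : Type*} (A : X → X → ℝ) {δ : ℝ} {t t' : ℕ} {f g : ℕ → X}
    (ht' : 0 < t') (hf : ∀ i < t, A (f i) (f (i + 1)) ≤ δ)
    (hg : ∀ i < t', A (g i) (g (i + 1)) ≤ δ) (hfg : f t = g 0) (hgf : g t' = f 0) :
    ∃ c : ℕ → X, c 0 = f 0 ∧ c t = f t ∧ c.Periodic (t + t') ∧
      ∀ i, A (c i) (c (i + 1)) ≤ δ := by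
  set w : ℕ → X := fun i => if i < t then f i else g (i - t) with hw
  have hw0 : w 0 = f 0 := by
    rcases Nat.eq_zero_or_pos t with rfl | h
    · simp [hw, hfg]
    · simp [hw, h]
  have hwn : w (t + t') = f 0 := by simp [hw, hgf]
  have hstep : ∀ i < t + t', A (w i) (w (i + 1)) ≤ δ := by
    intro i hi
    simp only [hw]
    rcases lt_trichotomy (i + 1) t with h | h | h
    · simpa [h, Nat.lt_of_succ_lt h] using hf i (by omega)
    · subst h
      simpa [← hfg] using hf i (by omega)
    · rw [if_neg (by omega), if_neg (by omega), Nat.sub_add_comm (by omega)]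
      exact hg _ (by omega)
  refine ⟨fun i => w (i % (t + t')), by simp [hw0], ?_, fun i => by simp, fun i => ?_⟩
  · have e : t % (t + t') = t := Nat.mod_eq_of_lt (by omega)
    simp [hw, e, hfg]
  · have hlt := Nat.mod_lt i (by omega : t + t' > 0)
    have := hstep _ hlt
    rcases Nat.lt_or_ge (i % (t + t') + 1) (t + t') with h | h
    · have e : (i + 1) % (t + t') = i % (t + t') + 1 := by
        rw [← Nat.mod_add_mod, Nat.mod_eq_of_lt h]
      simpa only [e] using this
    · have e' : i % (t + t') + 1 = t + t' := by omega
      have e : (i + 1) % (t + t') = 0 := by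
        rw [← Nat.mod_add_mod, e', Nat.mod_self]
      simpa only [e, hw0, e', hwn] using this

/-- Advancing `t` steps at a time around the closed walk through `a` and `b` leads from `b` back
to `a`. -/
theorem reflTransGen_of_max_ASR_le {X : Type*} [Finite X] (A : X → X → ℝ)
    (hself : ∀ x, A x x = 0) {δ : ℝ} (hδ : 0 ≤ δ) {t t' : ℕ} (ht : 0 < t) (ht' : 0 < t')
    {a b : X} (h : max (ASR A (t + 1) a b) (ASR A (t' + 1) b a) ≤ δ) :
    Relation.ReflTransGen
      (fun a b => max (ASR A (t + 1) a b) (ASR A (t' + 1) b a) ≤ δ) b a := by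
  rw [max_le_iff, ASR_le_iff A hself hδ ht, ASR_le_iff A hself hδ ht'] at h
  obtain ⟨⟨f, rfl, rfl, hf⟩, g, hg0, hgt, hg⟩ := h
  obtain ⟨c, hc0, hct, hper, hc⟩ := exists_periodic_walk A ht' hf hg hg0.symm hgt
  rw [← hc0, ← hct]
  have hreach : ∀ k, Relation.ReflTransGen
      (fun a b => max (ASR A (t + 1) a b) (ASR A (t' + 1) b a) ≤ δ) (c t) (c (t + k * t)) := by
    intro k
    induction k with
    | zero => simpa using Relation.ReflTransGen.refl
    | succ k ih =>
      refine ih.tail (max_le ?_ ?_)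
      · rw [ASR_le_iff A hself hδ ht]
        exact ⟨fun i => c (t + k * t + i), rfl, congrArg c (by ring), fun i _ => hc _⟩
      · rw [ASR_le_iff A hself hδ ht']
        refine ⟨fun i => c (t + (k + 1) * t + i), rfl, ?_, fun i _ => hc _⟩
        rw [← hper (t + k * t)]
        exact congrArg c (by ring)
  have hend : c (t + (t + t' - 1) * t) = c 0 := by
    have e : t + (t + t' - 1) * t = t * (t + t') := by
      obtain ⟨s, rfl⟩ := Nat.exists_eq_succ_of_ne_zero ht.ne'
      rw [show s.succ + t' - 1 = s + t' by omega, Nat.succ_eq_add_one]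
      ring
    simpa [e] using hper.nat_mul t 0
  exact hend ▸ hreach (t + t' - 1)

theorem uTT_le_uTT_swap {X : Type*} [Finite X] (A : X → X → ℝ) (hself : ∀ x, A x x = 0)
    {t t' : ℕ} (ht : 0 < t) (ht' : 0 < t') (x y : X) : uTT A t t' y x ≤ uTT A t t' x y := by
  have hδ : 0 ≤ uTT A t t' x y := minChainCost_nonneg _ x y
  refine (minChainCost_le_iff _ hδ y x).2 ?_
  have h := (minChainCost_le_iff _ hδ x y).1 (le_refl (uTT A t t' x y))
  generalize uTT A t t' x y = δ at hδ h ⊢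
  induction h with
  | refl => exact .refl
  | tail _ hbc ih => exact (reflTransGen_of_max_ASR_le A hself hδ ht ht' hbc).trans ih

/-- for positive integers t, t' the function u^{t,t'} is symmetric;
in particular, if u^{t,t'}(x,x') = δ then u^{t,t'}(x',x) ≤ δ. -/
theorem algorithmic_intermediate_symmetric {X : Type*} [Fintype X]
    (A : X → X → ℝ)
    (hnonneg : ∀ x x' : X, 0 ≤ A x x')
    (hid : ∀ x x' : X, A x x' = 0 ↔ x = x')
    (t t' : ℕ) (ht : 0 < t) (ht' : 0 < t') :
    (∀ x x' : X, uTT A t t' x x' = uTT A t t' x' x) ∧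
    (∀ (x x' : X) (δ : ℝ), uTT A t t' x x' = δ → uTT A t t' x' x ≤ δ) := by
  have hself : ∀ x, A x x = 0 := fun x => (hid x x).2 rfl
  have hsymm : ∀ x x' : X, uTT A t t' x x' = uTT A t t' x' x := fun x x' =>
    le_antisymm (uTT_le_uTT_swap A hself ht ht' x' x) (uTT_le_uTT_swap A hself ht ht' x x')
  exact ⟨hsymm, fun x x' δ h => ((hsymm x' x).trans h).le⟩
end
end
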